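/- arXiv:2107.03253 — 2 statements merged into one kernel-verified Lean document; each statement's English description precedes it below -/
import Mathlib

section
/- (Identification of λ.) Fix Q ≥ 3, K ≥ 1, T = 3, a true parameter θ⁰ = (β⁰, γ⁰, λ⁰) with λ⁰_1 < … < λ⁰_{Q−1}, and an initial outcome y_0 ∈ {1,…,Q}. Let ν be a finite Borel measure on (ℝ^K)^3 × ℝ (the joint distribution of the regressors X and the finite-valued fixed effect A given Y_0 = y_0; mass at A = ±∞ may be omitted because the moment function below vanishes on the constant paths (1,1,1) and (Q,Q,Q)). Assume ν((ℝ^K)^3 × ℝ) > 0 and that the functions x ↦ exp((x_2 − x_3)′β⁰), x ↦ exp((x_3 − x_1)′β⁰), x ↦ exp((x_2 − x_1)′β⁰) are integrable with respect to the x-marginal of ν. For λ ∈ ℝ^{Q−1} with λ_1 < … < λ_{Q−1} and q_1 ∈ {2,…,Q−1}, define m_{y_0,q_1,1,1}(y, x, β⁰, γ⁰, λ) casewise by: exp((x_2 − x_3)′β⁰ + γ⁰_{y_1} − γ⁰_1) − 1 if y_1 ≤ q_1, y_2 = 1, y_3 > 1; −1 if y_1 ≤ q_1, y_2 > 1; exp((x_3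 − x_1)′β⁰ + γ⁰_1 − γ⁰_{y_0} + λ_{q_1} − λ_1) if y_1 > q_1, y_2 = 1, y_3 = 1; exp((x_2 − x_1)′β⁰ + γ⁰_{y_1} − γ⁰_{y_0} + λ_{q_1} − λ_1) if y_1 > q_1, y_2 = 1, y_3 > 1; and 0 otherwise. If λ satisfies ∫_{(ℝ^K)^3 × ℝ} Σ_{y ∈ {1,…,Q}^3} m_{y_0,q_1,1,1}(y, x, β⁰, γ⁰, λ) · p_{y_0}(y, x, θ⁰, α) ν(dx, dα) = 0 for every q_1 ∈ {2,…,Q−1}, then there exists c ∈ ℝ such that λ_q = λ⁰_q + c for all q ∈ {1,…,Q−1}. In particular, under the normalization λ_1 = λ⁰_1 = 0 one has λ = λ⁰. -/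
open Finset MeasureTheory

/-- The logistic CDF `Λ(u) = 1/(1+exp(-u))`. -/
noncomputable def Lam (u : ℝ) : ℝ := 1 / (1 + Real.exp (-u))

/-- Probability that an ordered logit outcome with index `ζ` and thresholds
`lam` (categories `1,…,Q`, with the conventions `λ_0 = -∞`, `λ_Q = +∞`) equals `q`. -/
noncomputable def catProb (Q : ℕ) (lam : ℕ → ℝ) (ζ : ℝ) (q : ℕ) : ℝ :=
  (if q = 1 then 1 else Lam (ζ - lam (q - 1))) - (if q = Q then 0 else Lam (ζ - lam q))

lemma aux_Lam_pos (u : ℝ) : 0 < Lam u := by unfold Lam; positivity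

lemma aux_Lam_lt (u : ℝ) : Lam u < 1 := by
  unfold Lam
  rw [div_lt_one (by positivity)]
  linarith [Real.exp_pos (-u)]

lemma aux_Lam_cont : Continuous Lam := by
  unfold Lam
  refine Continuous.div (by fun_prop) (by fun_prop) ?_
  intro x
  positivity

lemma aux_Lam_exp (u : ℝ) : (1 - Lam u) * Real.exp u = Lam u := by
  unfold Lam
  rw [Real.exp_neg]
  have := Real.exp_pos u
  field_simp
  ring

lemma aux_cat_one (Q : ℕ) (hQ : 3 ≤ Q) (lam : ℕ → ℝ) (ζ : ℝ) :
    catProb Q lam ζ 1 = 1 - Lam (ζ - lam 1) := by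
  unfold catProb
  rw [if_pos rfl, if_neg (by omega)]

lemma aux_cat_sum (Q : ℕ) (lam : ℕ → ℝ) (ζ : ℝ) (n : ℕ) (hn : 1 ≤ n) (hnQ : n < Q) :
    ∑ q ∈ Finset.Icc 1 n, catProb Q lam ζ q = 1 - Lam (ζ - lam n) := by
  induction n, hn using Nat.le_induction with
  | base => simp [catProb]; omega
  | succ k hk ih =>
    rw [Finset.sum_Icc_succ_top (by omega), ih (by omega)]
    unfold catProb
    rw [if_neg (by omega), if_neg (by omega)]
    simp

lemma aux_cat_total (Q : ℕ) (hQ : 3 ≤ Q) (lam : ℕ → ℝ) (ζ : ℝ) :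
    ∑ q ∈ Finset.Icc 1 Q, catProb Q lam ζ q = 1 := by
  obtain ⟨k, rfl⟩ : ∃ k, Q = k + 1 := ⟨Q - 1, by omega⟩
  rw [Finset.sum_Icc_succ_top (by omega), aux_cat_sum _ _ _ k (by omega) (by omega)]
  unfold catProb
  rw [if_neg (by omega), if_pos rfl]
  simp

lemma aux_split (Q : ℕ) (hQ : 3 ≤ Q) (f : ℕ → ℝ) :
    ∑ q ∈ Finset.Icc 1 Q, f q = f 1 + ∑ q ∈ Finset.Ioc 1 Q, f q :=
  (Finset.add_sum_Ioc_eq_sum_Icc (by omega)).symm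

lemma aux_cat_tail (Q : ℕ) (hQ : 3 ≤ Q) (lam : ℕ → ℝ) (ζ : ℝ) :
    ∑ q ∈ Finset.Ioc 1 Q, catProb Q lam ζ q = Lam (ζ - lam 1) := by
  have h := aux_cat_total Q hQ lam ζ
  rw [aux_split Q hQ, aux_cat_one Q hQ] at h
  linarith

/-- Inner double sum with coefficients `e` at `(1,1)`, `f` at `(1,>1)`, `g` at `(>1,·)`. -/
lemma aux_inner (Q : ℕ) (hQ : 3 ≤ Q) (lam : ℕ → ℝ) (m : ℕ → ℕ → ℝ) (e f g p ζ : ℝ) (ξ : ℕ → ℝ)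
    (he : m 1 1 = e) (hf : ∀ y3, 1 < y3 → m 1 y3 = f) (hg : ∀ y2 y3, 1 < y2 → 1 ≤ y3 → m y2 y3 = g) :
    ∑ y2 ∈ Finset.Icc 1 Q, ∑ y3 ∈ Finset.Icc 1 Q,
      m y2 y3 * (p * catProb Q lam ζ y2 * catProb Q lam (ξ y2) y3) =
    p * ((1 - Lam (ζ - lam 1)) * (e * (1 - Lam (ξ 1 - lam 1)) + f * Lam (ξ 1 - lam 1))
      + g * Lam (ζ - lam 1)) := by
  have h1 : ∑ y3 ∈ Finset.Ioc 1 Q, m 1 y3 * (p * catProb Q lam ζ 1 * catProb Q lam (ξ 1) y3)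
      = f * (p * catProb Q lam ζ 1) * Lam (ξ 1 - lam 1) := by
    rw [← aux_cat_tail Q hQ, Finset.mul_sum]
    refine Finset.sum_congr rfl fun y hy => ?_
    rw [hf y (Finset.mem_Ioc.1 hy).1]; ring
  have h2 : ∑ y2 ∈ Finset.Ioc 1 Q, ∑ y3 ∈ Finset.Icc 1 Q,
      m y2 y3 * (p * catProb Q lam ζ y2 * catProb Q lam (ξ y2) y3) = g * p * Lam (ζ - lam 1) := by
    rw [← aux_cat_tail Q hQ, Finset.mul_sum]
    refine Finset.sum_congr rfl fun y hy => ?_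
    have : g * p * catProb Q lam ζ y = g * p * catProb Q lam ζ y *
        ∑ y3 ∈ Finset.Icc 1 Q, catProb Q lam (ξ y) y3 := by
      rw [aux_cat_total Q hQ, mul_one]
    rw [this, Finset.mul_sum]
    refine Finset.sum_congr rfl fun y3 hy3 => ?_
    rw [hg y y3 (Finset.mem_Ioc.1 hy).1 (Finset.mem_Icc.1 hy3).1]; ring
  rw [aux_split Q hQ, h2, aux_split Q hQ, h1, he, aux_cat_one Q hQ, aux_cat_one Q hQ]
  ring

/-- Pointwise evaluation of the moment function. -/
lemma aux_point (Q : ℕ) (hQ : 3 ≤ Q) (γ0 lam0 lam : ℕ → ℝ) (y0 q1 : ℕ) (hq : 2 ≤ q1)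
    (hq' : q1 < Q) (s1 s2 s3 a d23 d31 d21 : ℝ) (h23 : d23 = s2 - s3) (h31 : d31 = s3 - s1)
    (h21 : d21 = s2 - s1) :
    (∑ y1 ∈ Finset.Icc 1 Q, ∑ y2 ∈ Finset.Icc 1 Q, ∑ y3 ∈ Finset.Icc 1 Q,
          (if y1 ≤ q1 ∧ y2 = 1 ∧ 1 < y3 then
              Real.exp (d23 + (γ0 y1 - γ0 1)) - 1
            else if y1 ≤ q1 ∧ 1 < y2 then -1
            else if q1 < y1 ∧ y2 = 1 ∧ y3 = 1 then
              Real.exp (d31 + (γ0 1 - γ0 y0) + (lam q1 - lam 1))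
            else if q1 < y1 ∧ y2 = 1 ∧ 1 < y3 then
              Real.exp (d21 + (γ0 y1 - γ0 y0) + (lam q1 - lam 1))
            else 0) *
          (catProb Q lam0 (s1 + γ0 y0 + a) y1 *
            catProb Q lam0 (s2 + γ0 y1 + a) y2 *
            catProb Q lam0 (s3 + γ0 y2 + a) y3)) =
    (Real.exp (lam q1 - lam 1 + lam0 1 - lam0 q1) - 1) *
      (Lam (s3 + γ0 1 + a - lam0 1) * (1 - Lam (s1 + γ0 y0 + a - lam0 q1))) := by
  set B := Lam (s3 + γ0 1 + a - lam0 1) with hB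
  have hBe := aux_Lam_exp (s3 + γ0 1 + a - lam0 1)
  rw [← hB] at hBe
  have hlow : ∀ y1 ∈ Finset.Icc 1 Q, ∑ y2 ∈ Finset.Icc 1 Q, ∑ y3 ∈ Finset.Icc 1 Q,
          (if y1 ≤ q1 ∧ y2 = 1 ∧ 1 < y3 then
              Real.exp (d23 + (γ0 y1 - γ0 1)) - 1
            else if y1 ≤ q1 ∧ 1 < y2 then -1
            else if q1 < y1 ∧ y2 = 1 ∧ y3 = 1 then
              Real.exp (d31 + (γ0 1 - γ0 y0) + (lam q1 - lam 1))
            else if q1 < y1 ∧ y2 = 1 ∧ 1 < y3 then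
              Real.exp (d21 + (γ0 y1 - γ0 y0) + (lam q1 - lam 1))
            else 0) *
          (catProb Q lam0 (s1 + γ0 y0 + a) y1 *
            catProb Q lam0 (s2 + γ0 y1 + a) y2 *
            catProb Q lam0 (s3 + γ0 y2 + a) y3) =
        catProb Q lam0 (s1 + γ0 y0 + a) y1 *
          (Real.exp (lam q1 - lam 1 + lam0 1 - (s1 + γ0 y0 + a)) * B) -
        (if y1 ≤ q1 then catProb Q lam0 (s1 + γ0 y0 + a) y1 else 0) *
          (B + Real.exp (lam q1 - lam 1 + lam0 1 - (s1 + γ0 y0 + a)) * B) := by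
    intro y1 hy1
    have hAe := aux_Lam_exp (s2 + γ0 y1 + a - lam0 1)
    by_cases h : y1 ≤ q1
    · rw [aux_inner Q hQ lam0 _ 0 (Real.exp (d23 + (γ0 y1 - γ0 1)) - 1) (-1) _ _
        (fun y2 => s3 + γ0 y2 + a)]
      · simp only [if_pos h]
        rw [← hB]
        set A := Lam (s2 + γ0 y1 + a - lam0 1)
        have e : Real.exp (d23 + (γ0 y1 - γ0 1)) * Real.exp (s3 + γ0 1 + a - lam0 1) =
            Real.exp (s2 + γ0 y1 + a - lam0 1) := by
          rw [← Real.exp_add]; congr 1; rw [h23]; ring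
        have key : (1 - A) * (Real.exp (d23 + (γ0 y1 - γ0 1)) * B) = A * (1 - B) := by
          linear_combination -(1 - A) * Real.exp (d23 + (γ0 y1 - γ0 1)) * hBe +
            (1 - A) * (1 - B) * e + (1 - B) * hAe
        linear_combination catProb Q lam0 (s1 + γ0 y0 + a) y1 * key
      · simp [h]
      · intro y3 hy3; simp [h, hy3]
      · intro y2 y3 h2 _; simp [h, h2, h2.ne']
    · have h' : q1 < y1 := not_le.1 h
      rw [aux_inner Q hQ lam0 _ (Real.exp (d31 + (γ0 1 - γ0 y0) + (lam q1 - lam 1)))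
        (Real.exp (d21 + (γ0 y1 - γ0 y0) + (lam q1 - lam 1))) 0 _ _
        (fun y2 => s3 + γ0 y2 + a)]
      · simp only [if_neg h]
        rw [← hB]
        set A := Lam (s2 + γ0 y1 + a - lam0 1)
        set G := Real.exp (lam q1 - lam 1 + lam0 1 - (s1 + γ0 y0 + a)) with hG
        have e1 : Real.exp (d31 + (γ0 1 - γ0 y0) + (lam q1 - lam 1)) =
            G * Real.exp (s3 + γ0 1 + a - lam0 1) := by
          rw [hG, ← Real.exp_add]; congr 1; rw [h31]; ring
        have e2 : Real.exp (d21 + (γ0 y1 - γ0 y0) + (lam q1 - lam 1)) =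
            G * Real.exp (s2 + γ0 y1 + a - lam0 1) := by
          rw [hG, ← Real.exp_add]; congr 1; rw [h21]; ring
        rw [e1, e2]
        linear_combination catProb Q lam0 (s1 + γ0 y0 + a) y1 * G * ((1 - A) * hBe + B * hAe)
      · simp [h, h']
      · intro y3 hy3; simp [h, h', hy3, hy3.ne']
      · intro y2 y3 h2 _; simp [h, h2.ne']
  rw [Finset.sum_congr rfl hlow, Finset.sum_sub_distrib, ← Finset.sum_mul, ← Finset.sum_mul,
    aux_cat_total Q hQ, ← Finset.sum_filter]
  have hfil : (Finset.Icc 1 Q).filter (fun y => y ≤ q1) = Finset.Icc 1 q1 := by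
    ext y; simp only [Finset.mem_filter, Finset.mem_Icc]; omega
  rw [hfil, aux_cat_sum Q lam0 _ q1 (by omega) hq']
  have hCe := aux_Lam_exp (s1 + γ0 y0 + a - lam0 q1)
  set C := Lam (s1 + γ0 y0 + a - lam0 q1)
  have e3 : Real.exp (lam q1 - lam 1 + lam0 1 - lam0 q1) =
      Real.exp (lam q1 - lam 1 + lam0 1 - (s1 + γ0 y0 + a)) *
        Real.exp (s1 + γ0 y0 + a - lam0 q1) := by
    rw [← Real.exp_add]; congr 1; ring
  rw [e3]
  linear_combination -(Real.exp (lam q1 - lam 1 + lam0 1 - (s1 + γ0 y0 + a)) * B) * hCe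

theorem statement12 (Q K : ℕ) (hQ : 3 ≤ Q) (hK : 1 ≤ K)
    (β0 : Fin K → ℝ) (γ0 lam0 : ℕ → ℝ)
    (hlam0 : ∀ q r : ℕ, 1 ≤ q → q < r → r ≤ Q - 1 → lam0 q < lam0 r)
    (y0 : ℕ) (hy0 : y0 ∈ Finset.Icc 1 Q)
    (ν : Measure (((Fin K → ℝ) × (Fin K → ℝ) × (Fin K → ℝ)) × ℝ))
    [IsFiniteMeasure ν]
    (hpos : 0 < ν Set.univ)
    (hint : Integrable (fun x : (Fin K → ℝ) × (Fin K → ℝ) × (Fin K → ℝ) =>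
            Real.exp (∑ k, (x.2.1 k - x.2.2 k) * β0 k)) (ν.map Prod.fst) ∧
        Integrable (fun x : (Fin K → ℝ) × (Fin K → ℝ) × (Fin K → ℝ) =>
            Real.exp (∑ k, (x.2.2 k - x.1 k) * β0 k)) (ν.map Prod.fst) ∧
        Integrable (fun x : (Fin K → ℝ) × (Fin K → ℝ) × (Fin K → ℝ) =>
            Real.exp (∑ k, (x.2.1 k - x.1 k) * β0 k)) (ν.map Prod.fst))
    (lam : ℕ → ℝ)
    (hlam : ∀ q r : ℕ, 1 ≤ q → q < r → r ≤ Q - 1 → lam q < lam r)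
    (hmom : ∀ q1 ∈ Finset.Icc 2 (Q - 1),
      (∫ ω,
        (∑ y1 ∈ Finset.Icc 1 Q, ∑ y2 ∈ Finset.Icc 1 Q, ∑ y3 ∈ Finset.Icc 1 Q,
          (if y1 ≤ q1 ∧ y2 = 1 ∧ 1 < y3 then
              Real.exp ((∑ k, (ω.1.2.1 k - ω.1.2.2 k) * β0 k) + (γ0 y1 - γ0 1)) - 1
            else if y1 ≤ q1 ∧ 1 < y2 then -1
            else if q1 < y1 ∧ y2 = 1 ∧ y3 = 1 then
              Real.exp ((∑ k, (ω.1.2.2 k - ω.1.1 k) * β0 k) + (γ0 1 - γ0 y0) +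
                (lam q1 - lam 1))
            else if q1 < y1 ∧ y2 = 1 ∧ 1 < y3 then
              Real.exp ((∑ k, (ω.1.2.1 k - ω.1.1 k) * β0 k) + (γ0 y1 - γ0 y0) +
                (lam q1 - lam 1))
            else 0) *
          (catProb Q lam0 ((∑ k, ω.1.1 k * β0 k) + γ0 y0 + ω.2) y1 *
            catProb Q lam0 ((∑ k, ω.1.2.1 k * β0 k) + γ0 y1 + ω.2) y2 *
            catProb Q lam0 ((∑ k, ω.1.2.2 k * β0 k) + γ0 y2 + ω.2) y3)) ∂ν) = 0) :
    (∃ c : ℝ, ∀ q ∈ Finset.Icc 1 (Q - 1), lam q = lam0 q + c) ∧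
      (lam 1 = 0 → lam0 1 = 0 → ∀ q ∈ Finset.Icc 1 (Q - 1), lam q = lam0 q) := by
  have main : ∀ q ∈ Finset.Icc 1 (Q - 1), lam q = lam0 q + (lam 1 - lam0 1) := by
    intro q hq
    rw [Finset.mem_Icc] at hq
    rcases Nat.lt_or_ge 1 q with h1 | h1
    · have hm := hmom q (Finset.mem_Icc.2 ⟨h1, hq.2⟩)
      have hsub : ∀ u v : Fin K → ℝ, ∑ k, (u k - v k) * β0 k = ∑ k, u k * β0 k - ∑ k, v k * β0 k := by
        intro u v
        rw [← Finset.sum_sub_distrib]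
        exact Finset.sum_congr rfl fun k _ => by ring
      have hpt := fun s1 s2 s3 a : ℝ => aux_point Q hQ γ0 lam0 lam y0 q h1 (by omega)
        s1 s2 s3 a _ _ _ rfl rfl rfl
      simp only [hsub] at hm
      simp only [hpt] at hm
      rw [integral_const_mul] at hm
      rcases mul_eq_zero.1 hm with h | h
      · have h2 : Real.exp (lam q - lam 1 + lam0 1 - lam0 q) = 1 := by linarith
        rw [Real.exp_eq_one_iff] at h2
        linarith
      · exfalso
        rw [integral_eq_zero_iff_of_nonneg] at h
        · have hne : ν ≠ 0 := by
            rintro rfl; simp at hpos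
          have : (MeasureTheory.ae ν).NeBot := ae_neBot.2 hne
          obtain ⟨ω, hω⟩ := h.exists
          have := mul_pos (aux_Lam_pos (∑ k, ω.1.2.2 k * β0 k + γ0 1 + ω.2 - lam0 1))
            (sub_pos.2 (aux_Lam_lt (∑ k, ω.1.1 k * β0 k + γ0 y0 + ω.2 - lam0 q)))
          exact this.ne' hω
        · intro ω
          exact (mul_pos (aux_Lam_pos _) (sub_pos.2 (aux_Lam_lt _))).le
        · refine Integrable.of_bound (C := 1) ?_ ?_
          · apply Continuous.aestronglyMeasurable
            have := aux_Lam_cont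
            fun_prop
          · refine Filter.Eventually.of_forall fun ω => ?_
            have a1 := aux_Lam_pos (∑ k, ω.1.2.2 k * β0 k + γ0 1 + ω.2 - lam0 1)
            have a2 := aux_Lam_lt (∑ k, ω.1.2.2 k * β0 k + γ0 1 + ω.2 - lam0 1)
            have a3 := aux_Lam_pos (∑ k, ω.1.1 k * β0 k + γ0 y0 + ω.2 - lam0 q)
            have a4 := aux_Lam_lt (∑ k, ω.1.1 k * β0 k + γ0 y0 + ω.2 - lam0 q)
            rw [Real.norm_eq_abs, abs_of_pos (mul_pos a1 (sub_pos.2 a4))]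
            nlinarith
    · obtain rfl : q = 1 := by omega
      ring
  refine ⟨⟨_, main⟩, fun h h0 q hq => ?_⟩
  rw [main q hq, h, h0]; ring
end

section
/- (Label-reversal symmetry of the dynamic ordered logit model.) Fix Q ≥ 2, K ≥ 1 and T ≥ 1. Let θ = (β, γ, λ) be a parameter with λ_1 < … < λ_{Q−1}, and define the reversed parameter θ̄ = (β̄, γ̄, λ̄) by β̄ = −β, γ̄_q = −γ_{Q+1−q} for q ∈ {1,…,Q}, and λ̄_q = −λ_{Q−q} for q ∈ {1,…,Q−1} (so that λ̄_1 < … < λ̄_{Q−1}). For an outcome path y = (y_1,…,y_T) ∈ {1,…,Q}^T and initial outcome y_0, write ȳ_t = Q + 1 − y_t for t = 0,1,…,T and ȳ = (ȳ_1,…,ȳ_T). Then for every x ∈ (ℝ^K)^T and every α ∈ ℝ: p_{y_0}(y, x, θ, α) = p_{ȳ_0}(ȳ, x, θ̄, −α). -/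
open Finset

/-- The full outcome path `u ↦ y_u` on `{0,1,…,T}`, with initial outcome `y_0` and
post-initial outcomes `y = (y_1,…,y_T)`. -/
def fullPath (T y0 : ℕ) (y : Fin T → ℕ) : ℕ → ℕ :=
  fun u => if h : 1 ≤ u ∧ u ≤ T then y ⟨u - 1, by omega⟩ else y0

/-- The single index `z_u = x_u′β + γ_{y_{u-1}}` for a path `p`. -/
noncomputable def zidx {K : ℕ} (β : Fin K → ℝ) (γ : ℕ → ℝ)
    (x : ℕ → Fin K → ℝ) (p : ℕ → ℕ) (u : ℕ) : ℝ :=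
  (∑ k, x u k * β k) + γ (p (u - 1))

/-- Model probability `p_{y_0}(y, x, θ, α)` of a full outcome path `p : ℕ → ℕ`
(with `p 0` the initial outcome). -/
noncomputable def pathProb (Q T : ℕ) {K : ℕ} (β : Fin K → ℝ) (γ lam : ℕ → ℝ)
    (x : ℕ → Fin K → ℝ) (α : ℝ) (p : ℕ → ℕ) : ℝ :=
  ∏ u ∈ Finset.Icc 1 T, catProb Q lam (zidx β γ x p u + α) (p u)

theorem Lam_neg_eq (u : ℝ) : Lam (-u) = 1 - Lam u := by
  unfold Lam
  have h1 : 0 < Real.exp u := Real.exp_pos u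
  rw [neg_neg, Real.exp_neg]
  field_simp
  ring

theorem catProb_reverse (Q : ℕ) (lam : ℕ → ℝ) (ζ : ℝ) (q : ℕ) (h1 : 1 ≤ q) (h2 : q ≤ Q) :
    catProb Q lam ζ q = catProb Q (fun r => -lam (Q - r)) (-ζ) (Q + 1 - q) := by
  unfold catProb
  have e1 : (Q + 1 - q = 1) ↔ q = Q := by omega
  have e2 : (Q + 1 - q = Q) ↔ q = 1 := by omega
  have e3 : Q - (Q + 1 - q - 1) = q := by omega
  have e4 : Q - (Q + 1 - q) = q - 1 := by omega
  have e5 : ∀ a : ℝ, -ζ - -a = -(ζ - a) := fun a => by ring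
  simp only [e1, e2, e3, e4, e5, Lam_neg_eq]
  split_ifs <;> ring

theorem statement15 (Q K T : ℕ) (hQ : 2 ≤ Q) (hK : 1 ≤ K) (hT : 1 ≤ T)
    (β : Fin K → ℝ) (γ lam : ℕ → ℝ)
    (hlam : ∀ q r : ℕ, 1 ≤ q → q < r → r ≤ Q - 1 → lam q < lam r)
    (x : ℕ → Fin K → ℝ) (α : ℝ)
    (p : ℕ → ℕ) (hp : ∀ u ≤ T, p u ∈ Finset.Icc 1 Q) :
    pathProb Q T β γ lam x α p =
      pathProb Q T (fun k => -β k) (fun q => -γ (Q + 1 - q)) (fun q => -lam (Q - q))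
        x (-α) (fun u => Q + 1 - p u) := by
  unfold pathProb
  refine Finset.prod_congr rfl fun u hu => ?_
  have hu' := Finset.mem_Icc.mp hu
  have ha := Finset.mem_Icc.mp (hp u hu'.2)
  have hb := Finset.mem_Icc.mp (hp (u - 1) (by omega))
  rw [catProb_reverse Q lam _ _ ha.1 ha.2]
  congr 1
  have e : Q + 1 - (Q + 1 - p (u - 1)) = p (u - 1) := by omega
  simp only [zidx, e, mul_neg, Finset.sum_neg_distrib]
  ring
end
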